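/- Let p ∈ (1/2, 1) and let μ be an invariant probability distribution on ℕ for the kernel q_p. Then for every γ > 0: (2p − 1)(e^{γ} − 1)·Σ_{j=0}^{∞} p^{j+1} μ(j) = (1 − p)·Σ_{j=0}^{∞} (2 − e^{−γ})^{−(j+1)} μ(j) + ((2p − 1)e^{γ} − p)·Σ_{j=0}^{∞} e^{−γ j} μ(j), where all three series converge absolutely. -/

import Mathlib

open MeasureTheory Filter

noncomputable section

/-- The transition kernel of the Markov chain of leftward-jump counts associated with the
random walk in a homogeneous "have your cookie and eat it" environment with parameter `p`. -/
def qp (p : ℝ) (j k : ℕ) : ℝ :=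
  if k = 0 then p ^ (j + 1)
  else (1 - p) * ∑ l ∈ Finset.range (j + 1),
    p ^ l * (Nat.choose (j - l + k - 1) (k - 1) : ℝ) * ((1 : ℝ) / 2) ^ (j - l + k)

/-- `μ` is an invariant probability distribution on `ℕ` for the kernel `qp p`. -/
def IsInvariantFor (p : ℝ) (μ : ℕ → ℝ) : Prop :=
  (∀ k, 0 ≤ μ k) ∧ (∑' k, μ k) = 1 ∧ ∀ k, (∑' j, μ j * qp p j k) = μ k

theorem qp_nonneg {p : ℝ} (hp0 : 0 ≤ p) (hp1 : p ≤ 1) (j k : ℕ) : 0 ≤ qp p j k := by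
  have : 0 ≤ 1 - p := by linarith
  unfold qp
  split_ifs <;> positivity

theorem hasSum_qp_mul_pow (p : ℝ) {x : ℝ} (hx0 : 0 < x) (hx1 : x < 1) (j : ℕ) :
    HasSum (fun k => qp p j k * x ^ k)
      (p ^ (j + 1) + (1 - p) * x * ∑ l ∈ Finset.range (j + 1), p ^ l * (2 - x)⁻¹ ^ (j - l + 1)) := by
  have hcol (m : ℕ) : HasSum (fun i : ℕ => ((m + (i + 1) - 1).choose (i + 1 - 1) : ℝ) *
      (1 / 2) ^ (m + (i + 1)) * x ^ (i + 1)) (x * (2 - x)⁻¹ ^ (m + 1)) := by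
    have hnorm : ‖x / 2‖ < 1 := by
      rw [Real.norm_eq_abs, abs_of_pos (by positivity)]
      linarith
    have hval : x * (2 - x)⁻¹ ^ (m + 1) =
        x * (1 / 2) ^ (m + 1) * (1 / (1 - x / 2) ^ (m + 1)) := by
      have : (2 - x) ^ (m + 1) ≠ 0 := pow_ne_zero _ (by linarith)
      rw [show 1 - x / 2 = (2 - x) * (1 / 2) by ring, mul_pow, inv_pow]
      field_simp
    rw [hval]
    refine ((hasSum_choose_mul_geometric_of_norm_lt_one m hnorm).mul_left
      (x * (1 / 2) ^ (m + 1))).congr_fun fun i => ?_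
    rw [show m + (i + 1) - 1 = i + m by omega, Nat.add_sub_cancel, Nat.choose_symm_add]
    ring
  have htail : HasSum (fun i => qp p j (i + 1) * x ^ (i + 1))
      ((1 - p) * ∑ l ∈ Finset.range (j + 1), p ^ l * (x * (2 - x)⁻¹ ^ (j - l + 1))) := by
    refine ((hasSum_sum fun l (_ : l ∈ Finset.range (j + 1)) =>
      (hcol (j - l)).mul_left (p ^ l)).mul_left (1 - p)).congr_fun fun i => ?_
    rw [qp, if_neg i.succ_ne_zero, mul_assoc, Finset.sum_mul]
    congr 1
    refine Finset.sum_congr rfl fun l _ => ?_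
    ring
  have hval : p ^ (j + 1) +
      (1 - p) * x * ∑ l ∈ Finset.range (j + 1), p ^ l * (2 - x)⁻¹ ^ (j - l + 1) =
      qp p j 0 * x ^ 0 +
        (1 - p) * ∑ l ∈ Finset.range (j + 1), p ^ l * (x * (2 - x)⁻¹ ^ (j - l + 1)) := by
    rw [qp, if_pos rfl, pow_zero, mul_one, mul_assoc, Finset.mul_sum]
    simp only [mul_left_comm]
  rw [hval]
  exact htail.zero_add

theorem sum_pow_mul_inv_pow (p : ℝ) {x : ℝ} (hx : 2 - x ≠ 0) (j : ℕ) :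
    (2 * p - 1 - p * x) * ∑ l ∈ Finset.range (j + 1), p ^ l * (2 - x)⁻¹ ^ (j - l + 1) =
      p ^ (j + 1) - (2 - x)⁻¹ ^ (j + 1) := by
  have h := (Commute.all p (2 - x)⁻¹).mul_geom_sum₂ (j + 1)
  have hsum : ∑ l ∈ Finset.range (j + 1), p ^ l * (2 - x)⁻¹ ^ (j - l + 1) =
      (2 - x)⁻¹ * ∑ l ∈ Finset.range (j + 1), p ^ l * (2 - x)⁻¹ ^ (j + 1 - 1 - l) := by
    rw [Finset.mul_sum]
    refine Finset.sum_congr rfl fun l _ => ?_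
    rw [Nat.add_sub_cancel]
    ring
  rw [hsum, ← h, ← mul_assoc]
  congr 1
  field_simp
  ring

theorem IsInvariantFor.summable {p : ℝ} {μ : ℕ → ℝ} (hμ : IsInvariantFor p μ) : Summable μ := by
  by_contra h
  have := hμ.2.1
  rw [tsum_eq_zero_of_not_summable h] at this
  exact zero_ne_one this

theorem Summable.abs_mul_of_mem_Icc {μ : ℕ → ℝ} (hμ : Summable μ) {f : ℕ → ℝ}
    (hf : ∀ j, f j ∈ Set.Icc 0 1) : Summable fun j => |f j * μ j| := by
  refine Summable.of_nonneg_of_le (fun _ => abs_nonneg _) (fun j => ?_) hμ.abs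
  rw [abs_mul, abs_of_nonneg (hf j).1]
  exact mul_le_of_le_one_left (abs_nonneg _) (hf j).2

/-- The generating function of an invariant distribution is the `μ`-average of the generating
functions of the rows of the kernel. -/
theorem IsInvariantFor.tsum_pow_mul {p : ℝ} (hp0 : 0 ≤ p) (hp1 : p ≤ 1) {μ : ℕ → ℝ}
    (hμ : IsInvariantFor p μ) {x : ℝ} (hx0 : 0 ≤ x) {A : ℕ → ℝ}
    (hA : ∀ j, HasSum (fun k => qp p j k * x ^ k) (A j)) (hs : Summable fun j => μ j * A j) :
    ∑' j, x ^ j * μ j = ∑' j, μ j * A j := by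
  have hrow (j : ℕ) := (hA j).mul_left (μ j)
  have hF : Summable (Function.uncurry fun j k => μ j * (qp p j k * x ^ k)) := by
    rw [summable_prod_of_nonneg]
    · refine ⟨fun j => (hrow j).summable, ?_⟩
      convert hs using 2 with j
      exact (hrow j).tsum_eq
    · rintro ⟨j, k⟩
      exact mul_nonneg (hμ.1 j) (mul_nonneg (qp_nonneg hp0 hp1 j k) (pow_nonneg hx0 k))
  calc ∑' k, x ^ k * μ k = ∑' k, ∑' j, μ j * (qp p j k * x ^ k) := by
        refine tsum_congr fun k => ?_
        rw [← hμ.2.2 k, mul_comm, ← tsum_mul_right]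
        exact tsum_congr fun j => mul_assoc _ _ _
    _ = ∑' j, ∑' k, μ j * (qp p j k * x ^ k) := hF.tsum_comm
    _ = ∑' j, μ j * A j := tsum_congr fun j => (hrow j).tsum_eq

/-- The Laplace-transform identity satisfied by any invariant distribution of `qp p`. -/
theorem stmt17 (p : ℝ) (hp : p ∈ Set.Ioo (1 / 2 : ℝ) 1)
    (μ : ℕ → ℝ) (hμ : IsInvariantFor p μ) :
    ∀ γ : ℝ, 0 < γ →
      Summable (fun j : ℕ => |p ^ (j + 1) * μ j|) ∧
      Summable (fun j : ℕ => |(2 - Real.exp (-γ)) ^ (-((j : ℤ) + 1)) * μ j|) ∧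
      Summable (fun j : ℕ => |Real.exp (-γ * j) * μ j|) ∧
      (2 * p - 1) * (Real.exp γ - 1) * (∑' j : ℕ, p ^ (j + 1) * μ j) =
        (1 - p) * (∑' j : ℕ, (2 - Real.exp (-γ)) ^ (-((j : ℤ) + 1)) * μ j) +
        ((2 * p - 1) * Real.exp γ - p) * (∑' j : ℕ, Real.exp (-γ * j) * μ j) := by
  intro γ hγ
  obtain ⟨hp2, hp1⟩ := hp
  have hp0 : 0 < p := by linarith
  set x := Real.exp (-γ) with hx
  have hx0 : 0 < x := Real.exp_pos _
  have hx1 : x < 1 := by simpa [hx] using hγ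
  have hexp : Real.exp γ = x⁻¹ := by rw [hx, Real.exp_neg, inv_inv]
  have hpow (j : ℕ) : Real.exp (-γ * j) = x ^ j := by rw [mul_comm, Real.exp_nat_mul]
  have hzpow (j : ℕ) : (2 - x) ^ (-((j : ℤ) + 1)) = (2 - x)⁻¹ ^ (j + 1) := by
    rw [zpow_neg, inv_pow]
    norm_cast
  simp only [hexp, hpow, hzpow]
  set r := (2 - x)⁻¹ with hr
  have hr0 : 0 ≤ r := inv_nonneg.2 (by linarith)
  have hr1 : r ≤ 1 := inv_le_one_of_one_le₀ (by linarith)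
  have hunit {a : ℝ} (h0 : 0 ≤ a) (h1 : a ≤ 1) (n : ℕ) : a ^ n ∈ Set.Icc 0 1 :=
    ⟨pow_nonneg h0 n, pow_le_one₀ h0 h1⟩
  have hμs := hμ.summable
  have hP := hμs.abs_mul_of_mem_Icc fun j => hunit hp0.le hp1.le (j + 1)
  have hR := hμs.abs_mul_of_mem_Icc fun j => hunit hr0 hr1 (j + 1)
  have hG := hμs.abs_mul_of_mem_Icc fun j => hunit hx0.le hx1.le j
  refine ⟨hP, hR, hG, ?_⟩
  set S : ℕ → ℝ := fun j => ∑ l ∈ Finset.range (j + 1), p ^ l * r ^ (j - l + 1) with hS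
  have hS0 (j : ℕ) : 0 ≤ S j := Finset.sum_nonneg fun l _ => by positivity
  have hS1 (j : ℕ) : (1 - p) * S j ≤ 1 := by
    have hle : S j ≤ ∑ l ∈ Finset.range (j + 1), p ^ l := Finset.sum_le_sum fun l _ =>
      mul_le_of_le_one_right (by positivity) (hunit hr0 hr1 _).2
    calc (1 - p) * S j ≤ (1 - p) * ∑ l ∈ Finset.range (j + 1), p ^ l :=
          mul_le_mul_of_nonneg_left hle (by linarith)
      _ = 1 - p ^ (j + 1) := mul_neg_geom_sum p (j + 1)
      _ ≤ 1 := by linarith [pow_pos hp0 (j + 1)]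
  have hT : Summable fun j => (1 - p) * S j * μ j :=
    (hμs.abs_mul_of_mem_Icc fun j => ⟨mul_nonneg (by linarith) (hS0 j), hS1 j⟩).of_abs
  have hsplit (j : ℕ) : μ j * (p ^ (j + 1) + (1 - p) * x * S j) =
      p ^ (j + 1) * μ j + x * ((1 - p) * S j * μ j) := by ring
  have hgen := hμ.tsum_pow_mul hp0.le hp1.le hx0.le (hasSum_qp_mul_pow p hx0 hx1)
    ((summable_congr hsplit).2 (hP.of_abs.add (hT.mul_left x)))
  have hgen' : ∑' j, x ^ j * μ j =
      ∑' j, p ^ (j + 1) * μ j + x * ∑' j, (1 - p) * S j * μ j := by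
    rw [hgen, ← tsum_mul_left, ← hP.of_abs.tsum_add (hT.mul_left x)]
    exact tsum_congr hsplit
  have hgeom : (2 * p - 1 - p * x) * ∑' j, (1 - p) * S j * μ j =
      (1 - p) * (∑' j, p ^ (j + 1) * μ j - ∑' j, r ^ (j + 1) * μ j) := by
    rw [← hP.of_abs.tsum_sub hR.of_abs, ← tsum_mul_left, ← tsum_mul_left]
    refine tsum_congr fun j => ?_
    linear_combination (1 - p) * μ j * sum_pow_mul_inv_pow p (x := x) (by linarith) j
  rw [hgen']
  field_simp
  linear_combination -x * hgeom
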